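/- Let c ∈ ℝ and ε = ±1. Consider the Type B connection on the half-plane {x¹ > 0} with Christoffel symbols Γ_{11}^1 = (1+2c)/x¹, Γ_{12}^2 = Γ_{21}^2 = c/x¹, Γ_{22}^1 = ε/x¹ and all other Γ_{ij}^k = 0; its Ricci tensor is symmetric and equals ρ_s = (x¹)^{-2}(c(2+c)·dx¹⊗dx¹ + εc·dx²⊗dx²). The set of smooth f on {x¹ > 0} satisfying (Hf)₁₁ = −c(2+c)(x¹)^{-2}·f, (Hf)₁₂ = 0 and (Hf)₂₂ = −εc(x¹)^{-2}·f (the affine quasi-Einstein equation with μ = −1) is exactly the real span of the three functions (x¹)^c, (x¹)^c·x², and (x¹)^c·((x²)² + ε(x¹)²). -/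

import Mathlib

/-- Partial derivative in the first coordinate direction. -/
noncomputable def pd1 (f : ℝ × ℝ → ℝ) : ℝ × ℝ → ℝ := fun p => fderiv ℝ f p (1, 0)

/-- Partial derivative in the second coordinate direction. -/
noncomputable def pd2 (f : ℝ × ℝ → ℝ) : ℝ × ℝ → ℝ := fun p => fderiv ℝ f p (0, 1)

theorem openU : IsOpen {p : ℝ × ℝ | 0 < p.1} := isOpen_lt continuous_const continuous_fst

theorem line1 {F : ℝ × ℝ → ℝ} {x y : ℝ} (h : DifferentiableAt ℝ F (x, y)) :
    HasDerivAt (fun t => F (t, y)) (pd1 F (x, y)) x := by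
  have h2 : HasDerivAt (fun t : ℝ => ((t, y) : ℝ × ℝ)) (1, 0) x :=
    (hasDerivAt_id x).prodMk (hasDerivAt_const x y)
  exact HasFDerivAt.comp_hasDerivAt (f := fun t : ℝ => ((t, y) : ℝ × ℝ)) x h.hasFDerivAt h2

theorem line2 {F : ℝ × ℝ → ℝ} {x y : ℝ} (h : DifferentiableAt ℝ F (x, y)) :
    HasDerivAt (fun t => F (x, t)) (pd2 F (x, y)) y := by
  have h2 : HasDerivAt (fun t : ℝ => ((x, t) : ℝ × ℝ)) (0, 1) y :=
    (hasDerivAt_const y x).prodMk (hasDerivAt_id y)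
  exact HasFDerivAt.comp_hasDerivAt (f := fun t : ℝ => ((x, t) : ℝ × ℝ)) y h.hasFDerivAt h2

theorem pd_congr {F G : ℝ × ℝ → ℝ} (h : ∀ p : ℝ × ℝ, 0 < p.1 → F p = G p) (p : ℝ × ℝ)
    (hp : 0 < p.1) : pd1 F p = pd1 G p ∧ pd2 F p = pd2 G p := by
  have : F =ᶠ[nhds p] G := by
    filter_upwards [openU.mem_nhds hp] with q hq using h q hq
  simp [pd1, pd2, this.fderiv_eq]

theorem cst {F : ℝ × ℝ → ℝ}
    (h1 : ∀ x y : ℝ, 0 < x → HasDerivAt (fun t => F (t, y)) 0 x)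
    (h2 : ∀ x y : ℝ, 0 < x → HasDerivAt (fun t => F (x, t)) 0 y) :
    ∃ k, ∀ x y : ℝ, 0 < x → F (x, y) = k := by
  refine ⟨F (1, 0), fun x y hx => ?_⟩
  have e1 : F (x, y) = F (1, y) := by
    refine (isOpen_Ioi (a := (0:ℝ))).is_const_of_deriv_eq_zero (f := fun t => F (t, y))
      isPreconnected_Ioi ?_ ?_ hx (Set.mem_Ioi.2 one_pos)
    · intro t ht
      exact (h1 t y ht).differentiableAt.differentiableWithinAt
    · intro t ht
      exact (h1 t y ht).deriv
  have e2 : F (1, y) = F (1, 0) :=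
    is_const_of_deriv_eq_zero (f := fun t => F (1, t))
      (fun t => (h2 1 t one_pos).differentiableAt) (fun t => (h2 1 t one_pos).deriv) y 0
  rw [e1, e2]

theorem pw (c x : ℝ) (hx : 0 < x) : HasDerivAt (fun t : ℝ => t ^ c) (c * (x ^ c / x)) x := by
  have := Real.hasDerivAt_rpow_const (x := x) (p := c) (Or.inl hx.ne')
  rwa [Real.rpow_sub_one hx.ne'] at this

theorem pd_smooth {F : ℝ × ℝ → ℝ} (h : ContDiffOn ℝ (⊤ : ℕ∞) F {p : ℝ × ℝ | 0 < p.1})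
    (v : ℝ × ℝ) :
    ContDiffOn ℝ (⊤ : ℕ∞) (fun p => fderiv ℝ F p v) {p : ℝ × ℝ | 0 < p.1} :=
  (h.fderiv_of_isOpen openU (by simp)).clm_apply contDiffOn_const

theorem diffAt {F : ℝ × ℝ → ℝ} (h : ContDiffOn ℝ (⊤ : ℕ∞) F {p : ℝ × ℝ | 0 < p.1})
    {x y : ℝ} (hx : 0 < x) : DifferentiableAt ℝ F (x, y) :=
  (h.contDiffAt (openU.mem_nhds hx)).differentiableAt (by simp)

theorem pd_symm {F : ℝ × ℝ → ℝ} (h : ContDiffOn ℝ (⊤ : ℕ∞) F {p : ℝ × ℝ | 0 < p.1})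
    {p : ℝ × ℝ} (hp : 0 < p.1) : pd2 (pd1 F) p = pd1 (pd2 F) p := by
  have hc := h.contDiffAt (openU.mem_nhds hp)
  have hs : IsSymmSndFDerivAt ℝ F p := hc.isSymmSndFDerivAt (by
    simp only [minSmoothness_of_isRCLikeNormedField]
    exact WithTop.coe_le_coe.2 (le_top : (2 : ℕ∞) ≤ ⊤))
  have hd : DifferentiableAt ℝ (fderiv ℝ F) p :=
    ((h.fderiv_of_isOpen (m := (⊤ : ℕ∞)) openU (by simp)).contDiffAt
      (openU.mem_nhds hp)).differentiableAt (by simp)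
  have e : ∀ v w : ℝ × ℝ, fderiv ℝ (fun q => fderiv ℝ F q v) p w
      = fderiv ℝ (fderiv ℝ F) p w v := by
    intro v w
    rw [fderiv_clm_apply hd (differentiableAt_const v)]
    simp
  change fderiv ℝ (fun q => fderiv ℝ F q (1, 0)) p (0, 1)
    = fderiv ℝ (fun q => fderiv ℝ F q (0, 1)) p (1, 0)
  rw [e, e]
  exact hs.eq _ _

/-- auxiliary smoothness -/
theorem smU (c : ℝ) : ContDiffOn ℝ (⊤ : ℕ∞) (fun p : ℝ × ℝ => p.1 ^ c)
    {p : ℝ × ℝ | 0 < p.1} := fun p hp =>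
  (contDiffAt_fst.rpow_const_of_ne (ne_of_gt hp)).contDiffWithinAt

theorem fwd (c ε : ℝ) (hε : ε * ε = 1) (f : ℝ × ℝ → ℝ)
    (hf : ContDiffOn ℝ (⊤ : ℕ∞) f {p : ℝ × ℝ | 0 < p.1})
    (H : ∀ p : ℝ × ℝ, 0 < p.1 →
        pd1 (pd1 f) p - ((1 + 2 * c) / p.1) * pd1 f p
          = -(c * (2 + c) / p.1 ^ 2) * f p ∧
        pd1 (pd2 f) p - (c / p.1) * pd2 f p = 0 ∧
        pd2 (pd2 f) p - (ε / p.1) * pd1 f p = -(ε * c / p.1 ^ 2) * f p) :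
    (∃ a b d : ℝ, ∀ p : ℝ × ℝ, 0 < p.1 →
      f p = a * p.1 ^ c + b * (p.1 ^ c * p.2)
          + d * (p.1 ^ c * (p.2 ^ 2 + ε * p.1 ^ 2))) := by
  have s1 : ContDiffOn ℝ (⊤ : ℕ∞) (pd1 f) {p : ℝ × ℝ | 0 < p.1} := pd_smooth hf _
  have s2 : ContDiffOn ℝ (⊤ : ℕ∞) (pd2 f) {p : ℝ × ℝ | 0 < p.1} := pd_smooth hf _
  have l1 := fun x y (hx : 0 < x) => line1 (diffAt hf (y := y) hx)
  have l2 := fun x y (hx : 0 < x) => line2 (diffAt hf (y := y) hx)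
  have l11 := fun x y (hx : 0 < x) => line1 (diffAt s1 (y := y) hx)
  have l12 := fun x y (hx : 0 < x) => line2 (diffAt s1 (y := y) hx)
  have l21 := fun x y (hx : 0 < x) => line1 (diffAt s2 (y := y) hx)
  have l22 := fun x y (hx : 0 < x) => line2 (diffAt s2 (y := y) hx)
  have v11 : ∀ x y : ℝ, 0 < x → pd1 (pd1 f) (x, y) =
      ((1 + 2 * c) / x) * pd1 f (x, y) - (c * (2 + c) / x ^ 2) * f (x, y) := by
    intro x y hx
    have := (H (x, y) hx).1
    simp only at this
    linarith
  have v21 : ∀ x y : ℝ, 0 < x → pd1 (pd2 f) (x, y) = (c / x) * pd2 f (x, y) := by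
    intro x y hx
    have := (H (x, y) hx).2.1
    simp only at this
    linarith
  have v22 : ∀ x y : ℝ, 0 < x → pd2 (pd2 f) (x, y) =
      (ε / x) * pd1 f (x, y) - (ε * c / x ^ 2) * f (x, y) := by
    intro x y hx
    have := (H (x, y) hx).2.2
    simp only at this
    linarith
  have v12 : ∀ x y : ℝ, 0 < x → pd2 (pd1 f) (x, y) = (c / x) * pd2 f (x, y) := by
    intro x y hx
    rw [pd_symm hf (p := (x, y)) hx, v21 x y hx]
  obtain ⟨D, hD⟩ := cst (F := fun p => p.1 ^ (-c) * (pd1 f p / p.1 - c * f p / p.1 ^ 2))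
    (by
      intro x y hx
      have := (pw (-c) x hx).mul (((l11 x y hx).div (hasDerivAt_id x) hx.ne').sub
        (((l1 x y hx).const_mul c).div ((hasDerivAt_id x).pow 2) (pow_ne_zero 2 hx.ne')))
      refine this.congr_deriv ?_
      simp only [v11 x y hx, id]
      simp
      field_simp
      ring)
    (by
      intro x y hx
      have := (((l12 x y hx).div_const x).sub
        (((l2 x y hx).const_mul c).div_const (x ^ 2))).const_mul (x ^ (-c))
      refine this.congr_deriv ?_
      simp only [v12 x y hx]
      field_simp
      ring)
  have hD' : ∀ x y : ℝ, 0 < x → pd1 f (x, y) = x * (x ^ c * D) + c * f (x, y) / x := by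
    intro x y hx
    rw [← hD x y hx]
    have := (Real.rpow_pos_of_pos hx c).ne'
    simp only [Real.rpow_neg hx.le]
    field_simp
    ring
  obtain ⟨B, hB⟩ := cst (F := fun p => p.1 ^ (-c) * pd2 f p - ε * D * p.2)
    (by
      intro x y hx
      have := ((pw (-c) x hx).mul (l21 x y hx)).sub_const (ε * D * y)
      refine this.congr_deriv ?_
      simp only [v21 x y hx]
      field_simp
      ring)
    (by
      intro x y hx
      have := ((l22 x y hx).const_mul (x ^ (-c))).sub ((hasDerivAt_id y).const_mul (ε * D))
      refine this.congr_deriv ?_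
      simp only [v22 x y hx, hD' x y hx]
      have := (Real.rpow_pos_of_pos hx c).ne'
      simp only [Real.rpow_neg hx.le]
      field_simp
      ring)
  have hB' : ∀ x y : ℝ, 0 < x → pd2 f (x, y) = x ^ c * (B + ε * D * y) := by
    intro x y hx
    rw [← hB x y hx]
    have := (Real.rpow_pos_of_pos hx c).ne'
    simp only [Real.rpow_neg hx.le]
    field_simp
    ring
  obtain ⟨A, hA⟩ := cst (F := fun p => p.1 ^ (-c) * f p - (B * p.2 + (ε * D / 2 * p.2 ^ 2
      + D / 2 * p.1 ^ 2)))
    (by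
      intro x y hx
      have := ((pw (-c) x hx).mul (l1 x y hx)).sub (((((hasDerivAt_id x).pow 2).const_mul
        (D / 2)).const_add (ε * D / 2 * y ^ 2)).const_add (B * y))
      refine this.congr_deriv ?_
      simp only [hD' x y hx, id]
      have := (Real.rpow_pos_of_pos hx c).ne'
      simp only [Real.rpow_neg hx.le]
      simp
      field_simp
      ring)
    (by
      intro x y hx
      have := ((l2 x y hx).const_mul (x ^ (-c))).sub (((hasDerivAt_id y).const_mul B).add
        ((((hasDerivAt_id y).pow 2).const_mul (ε * D / 2)).add_const (D / 2 * x ^ 2)))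
      refine this.congr_deriv ?_
      simp only [hB' x y hx, id]
      have := (Real.rpow_pos_of_pos hx c).ne'
      simp only [Real.rpow_neg hx.le]
      simp
      field_simp
      ring)
  refine ⟨A, B, ε * D / 2, ?_⟩
  rintro ⟨x, y⟩ hx
  simp only at hx
  rw [← hA x y hx]
  have := (Real.rpow_pos_of_pos hx c).ne'
  simp only [Real.rpow_neg hx.le]
  field_simp
  linear_combination (-(D * x ^ 2 * x ^ c)) * hε

theorem bwd (c ε a b d : ℝ) (hε : ε * ε = 1) (f : ℝ × ℝ → ℝ)
    (H : ∀ p : ℝ × ℝ, 0 < p.1 →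
      f p = a * p.1 ^ c + b * (p.1 ^ c * p.2)
          + d * (p.1 ^ c * (p.2 ^ 2 + ε * p.1 ^ 2))) :
    ContDiffOn ℝ (⊤ : ℕ∞) f {p : ℝ × ℝ | 0 < p.1} ∧
      ∀ p : ℝ × ℝ, 0 < p.1 →
        pd1 (pd1 f) p - ((1 + 2 * c) / p.1) * pd1 f p
          = -(c * (2 + c) / p.1 ^ 2) * f p ∧
        pd1 (pd2 f) p - (c / p.1) * pd2 f p = 0 ∧
        pd2 (pd2 f) p - (ε / p.1) * pd1 f p = -(ε * c / p.1 ^ 2) * f p := by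
  have hf : ContDiffOn ℝ (⊤ : ℕ∞) f {p : ℝ × ℝ | 0 < p.1} := by
    refine ContDiffOn.congr ?_ (fun p hp => H p hp)
    have := smU c
    have i1 : ContDiffOn ℝ (⊤ : ℕ∞) (fun p : ℝ × ℝ => p.1) {p : ℝ × ℝ | 0 < p.1} :=
      contDiffOn_fst
    have i2 : ContDiffOn ℝ (⊤ : ℕ∞) (fun p : ℝ × ℝ => p.2) {p : ℝ × ℝ | 0 < p.1} :=
      contDiffOn_snd
    exact ((contDiffOn_const.mul this).add (contDiffOn_const.mul (this.mul i2))).add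
      (contDiffOn_const.mul (this.mul ((i2.pow 2).add (contDiffOn_const.mul (i1.pow 2)))))
  have s1 : ContDiffOn ℝ (⊤ : ℕ∞) (pd1 f) {p : ℝ × ℝ | 0 < p.1} := pd_smooth hf _
  have s2 : ContDiffOn ℝ (⊤ : ℕ∞) (pd2 f) {p : ℝ × ℝ | 0 < p.1} := pd_smooth hf _
  have nh : ∀ x : ℝ, 0 < x → ∀ᶠ t in nhds x, 0 < t := fun x hx => lt_mem_nhds hx
  have e1 : ∀ x y : ℝ, 0 < x → pd1 f (x, y) =
      x ^ c * (c * (a + b * y + d * y ^ 2) * x⁻¹ + (c + 2) * d * ε * x) := by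
    intro x y hx
    refine (line1 (diffAt hf hx)).unique ?_
    have h0 := (pw c x hx).mul ((((hasDerivAt_id x).pow 2).const_mul (d * ε)).const_add
      (a + b * y + d * y ^ 2))
    refine (h0.congr_deriv ?_).congr_of_eventuallyEq ?_
    · simp
      field_simp
      ring
    · filter_upwards [nh x hx] with t ht
      simp [H (t, y) ht]
      ring
  have e2 : ∀ x y : ℝ, 0 < x → pd2 f (x, y) = x ^ c * (b + 2 * d * y) := by
    intro x y hx
    refine (line2 (diffAt hf hx)).unique ?_
    have h0 := ((((hasDerivAt_id y).const_mul b).add (((hasDerivAt_id y).pow 2).const_mul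
      d)).const_add (a + d * ε * x ^ 2)).const_mul (x ^ c)
    refine (h0.congr_deriv ?_).congr_of_eventuallyEq ?_
    · simp
      left
      ring
    · filter_upwards with t
      simp [H (x, t) hx]
      ring
  have e11 : ∀ x y : ℝ, 0 < x → pd1 (pd1 f) (x, y) =
      x ^ c * (c * (c - 1) * (a + b * y + d * y ^ 2) / x ^ 2 + (c + 1) * (c + 2) * d * ε) := by
    intro x y hx
    refine (line1 (diffAt s1 hx)).unique ?_
    have h0 := (pw c x hx).mul (((hasDerivAt_inv hx.ne').const_mul
      (c * (a + b * y + d * y ^ 2))).add ((hasDerivAt_id x).const_mul ((c + 2) * d * ε)))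
    refine (h0.congr_deriv ?_).congr_of_eventuallyEq ?_
    · simp
      field_simp
      ring
    · filter_upwards [nh x hx] with t ht
      simp [e1 t y ht]
  have e21 : ∀ x y : ℝ, 0 < x → pd1 (pd2 f) (x, y) = c * (x ^ c / x) * (b + 2 * d * y) := by
    intro x y hx
    refine (line1 (diffAt s2 hx)).unique ?_
    refine ((pw c x hx).mul_const (b + 2 * d * y)).congr_of_eventuallyEq ?_
    filter_upwards [nh x hx] with t ht
    simp [e2 t y ht]
  have e22 : ∀ x y : ℝ, 0 < x → pd2 (pd2 f) (x, y) = x ^ c * (2 * d) := by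
    intro x y hx
    refine (line2 (diffAt s2 hx)).unique ?_
    have h0 := (((hasDerivAt_id y).const_mul (2 * d)).const_add b).const_mul (x ^ c)
    refine (h0.congr_deriv ?_).congr_of_eventuallyEq ?_
    · simp
    · filter_upwards with t
      simp [e2 x t hx]
  refine ⟨hf, ?_⟩
  rintro ⟨x, y⟩ hx
  simp only at hx
  rw [e11 x y hx, e1 x y hx, e21 x y hx, e2 x y hx, e22 x y hx, H (x, y) hx]
  simp only
  refine ⟨?_, ?_, ?_⟩
  · field_simp
    ring
  · field_simp
    ring
  · field_simp
    linear_combination (-(2 * d * x ^ 2)) * hε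

/-- For the strongly projectively flat Type B connection with Γ₁₁¹ = (1+2c)/x¹,
Γ₁₂² = c/x¹, Γ₂₂¹ = ε/x¹ (ε = ±1, others zero,
ρ_s = (x¹)⁻²(c(2+c)dx¹⊗dx¹ + εc dx²⊗dx²)) on {x¹ > 0}, the smooth solutions of the
affine quasi-Einstein equation with μ = −1 are exactly the span of (x¹)^c, (x¹)^c x²
and (x¹)^c((x²)² + ε(x¹)²). -/
theorem stmt18 (c ε : ℝ) (hε : ε = 1 ∨ ε = -1) (f : ℝ × ℝ → ℝ) :
    (ContDiffOn ℝ (⊤ : ℕ∞) f {p : ℝ × ℝ | 0 < p.1} ∧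
      ∀ p : ℝ × ℝ, 0 < p.1 →
        pd1 (pd1 f) p - ((1 + 2 * c) / p.1) * pd1 f p
          = -(c * (2 + c) / p.1 ^ 2) * f p ∧
        pd1 (pd2 f) p - (c / p.1) * pd2 f p = 0 ∧
        pd2 (pd2 f) p - (ε / p.1) * pd1 f p = -(ε * c / p.1 ^ 2) * f p) ↔
    (∃ a b d : ℝ, ∀ p : ℝ × ℝ, 0 < p.1 →
      f p = a * p.1 ^ c + b * (p.1 ^ c * p.2)
          + d * (p.1 ^ c * (p.2 ^ 2 + ε * p.1 ^ 2))) := by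
  have he : ε * ε = 1 := by rcases hε with h | h <;> simp [h]
  constructor
  · rintro ⟨hf, H⟩
    exact fwd c ε he f hf H
  · rintro ⟨a, b, d, H⟩
    exact bwd c ε a b d he f H
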